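/- arXiv:1709.02507 — 2 statements merged into one kernel-verified Lean document; each statement's English description precedes it below -/
import Mathlib

section
/- Let p and ℓ be distinct primes. The Fourier transform α ↦ α̂, where α̂(ζ) = ∫_{ℤ_p} ζ^x dα(x) for ζ ∈ μ_{p^∞}, is a ring isomorphism from the ring of 𝔽̄_ℓ-valued measures on ℤ_p (with pointwise addition and convolution as multiplication) onto the ring of all 𝔽̄_ℓ-valued functions on μ_{p^∞} (with pointwise addition and multiplication), and its inverse is f ↦ f̌, where f̌(a + p^nℤ_p) = p^{-n} Σ_{ζ^{p^n}=1} f(ζ) ζ^{-a}. -/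
/-!
STATEMENT 0: The Fourier transform `α ↦ α̂`, `α̂(ζ) = ∫_{ℤ_p} ζ^x dα(x)` for
`ζ ∈ μ_{p^∞} ⊆ 𝔽̄_ℓ`, is a ring isomorphism from the ring of `𝔽̄_ℓ`-valued measures
on `ℤ_p` (pointwise addition, convolution product) onto the ring of all
`𝔽̄_ℓ`-valued functions on `μ_{p^∞}` (pointwise operations), with inverse
`f ↦ f̌`, `f̌(a + p^n ℤ_p) = p^{-n} ∑_{ζ^{p^n}=1} f(ζ) ζ^{-a}`.
-/

open scoped BigOperators Classical

/-- The coset `a + p^n ℤ_p` inside `ℤ_p`. -/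
def padicCoset (p : ℕ) [Fact p.Prime] (a : ℤ_[p]) (n : ℕ) : Set ℤ_[p] :=
  {x : ℤ_[p] | ∃ y : ℤ_[p], x = a + (p : ℤ_[p]) ^ n * y}

/-- An `R`-valued measure on `ℤ_p`: a finitely additive `R`-valued function on
the compact open subsets of `ℤ_p`. -/
structure PadicMeasure (p : ℕ) [Fact p.Prime] (R : Type*) [AddCommMonoid R] where
  toFun : Set ℤ_[p] → R
  additive : ∀ U V : Set ℤ_[p], IsCompact U → IsOpen U → IsCompact V → IsOpen V →
    Disjoint U V → toFun (U ∪ V) = toFun U + toFun V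

/-- Pointwise addition of measures. -/
instance {p : ℕ} [Fact p.Prime] {R : Type*} [AddCommMonoid R] : Add (PadicMeasure p R) :=
  ⟨fun α β =>
    { toFun := fun U => α.toFun U + β.toFun U
      additive := by
        intro U V hUc hUo hVc hVo hUV
        rw [α.additive U V hUc hUo hVc hVo hUV, β.additive U V hUc hUo hVc hVo hUV]
        exact add_add_add_comm _ _ _ _ }⟩

/-- The Fourier transform `α̂(ζ) = ∫_{ℤ_p} ζ^x dα(x)` of a measure, computed at
level `n` (this is the honest value whenever `ζ ^ p ^ n = 1`). -/
noncomputable def fourierAt {p : ℕ} [Fact p.Prime] {R : Type*} [CommRing R]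
    (α : PadicMeasure p R) (n : ℕ) (ζ : R) : R :=
  ∑ a ∈ Finset.range (p ^ n), ζ ^ a * α.toFun (padicCoset p (a : ℤ_[p]) n)

/-- `γ` is the convolution `α * β`:  for any compact open `U` which is a union of
cosets of `p^n ℤ_p`, `γ(U) = ∫∫ 1_U(x+y) dα(x) dβ(y)`. -/
def IsConvolution {p : ℕ} [Fact p.Prime] {R : Type*} [CommRing R]
    (α β γ : PadicMeasure p R) : Prop :=
  ∀ (n : ℕ) (U : Set ℤ_[p]), IsCompact U → IsOpen U →
    (∀ x ∈ U, padicCoset p x n ⊆ U) →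
    γ.toFun U = ∑ a ∈ Finset.range (p ^ n), ∑ b ∈ Finset.range (p ^ n),
      (if ((a : ℤ_[p]) + (b : ℤ_[p])) ∈ U then
        α.toFun (padicCoset p (a : ℤ_[p]) n) * β.toFun (padicCoset p (b : ℤ_[p]) n) else 0)

/-- The group `μ_{p^∞}` of `p`-power roots of unity in a field `F`. -/
def muPInfty (p : ℕ) (F : Type*) [Field F] : Type _ := {ζ : F // ∃ n : ℕ, ζ ^ p ^ n = 1}


section Helpers

variable {p : ℕ} [Fact p.Prime] {F : Type*} [Field F]

lemma mem_padicCoset_iff (x a : ℤ_[p]) (n : ℕ) :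
    x ∈ padicCoset p a n ↔ (p : ℤ_[p]) ^ n ∣ x - a := by
  constructor
  · rintro ⟨y, rfl⟩
    exact ⟨y, by ring⟩
  · rintro ⟨y, hy⟩
    exact ⟨y, by rw [← hy]; ring⟩

lemma mem_padicCoset_norm (x a : ℤ_[p]) (n : ℕ) :
    x ∈ padicCoset p a n ↔ ‖x - a‖ ≤ (p : ℝ) ^ (-n : ℤ) := by
  rw [mem_padicCoset_iff, PadicInt.norm_le_pow_iff_mem_span_pow, Ideal.mem_span_singleton]

lemma natCast_mem_padicCoset (b a n : ℕ) :
    (b : ℤ_[p]) ∈ padicCoset p (a : ℤ_[p]) n ↔ b % p ^ n = a % p ^ n := by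
  rw [mem_padicCoset_iff]
  have h := PadicInt.pow_p_dvd_int_iff (p := p) n ((b : ℤ) - (a : ℤ))
  push_cast at h
  rw [h]
  have h2 := Nat.modEq_iff_dvd (n := p ^ n) (a := a) (b := b)
  push_cast at h2
  rw [← h2]
  exact eq_comm

lemma self_mem_padicCoset (a : ℤ_[p]) (n : ℕ) : a ∈ padicCoset p a n := by
  rw [mem_padicCoset_iff]; simp

lemma padicCoset_symm {x a : ℤ_[p]} {n : ℕ} (h : x ∈ padicCoset p a n) :
    a ∈ padicCoset p x n := by
  rw [mem_padicCoset_iff] at *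
  rw [← neg_sub]; exact (dvd_neg).2 h

lemma padicCoset_subset {x a : ℤ_[p]} {m n : ℕ} (hmn : m ≤ n) (h : x ∈ padicCoset p a m) :
    padicCoset p x n ⊆ padicCoset p a m := by
  intro y hy
  rw [mem_padicCoset_iff] at *
  have := dvd_add ((pow_dvd_pow _ hmn).trans hy) h
  simpa using this

lemma padicCoset_eq {x a : ℤ_[p]} {n : ℕ} (h : x ∈ padicCoset p a n) :
    padicCoset p x n = padicCoset p a n :=
  Set.Subset.antisymm (padicCoset_subset le_rfl h)
    (padicCoset_subset le_rfl (padicCoset_symm h))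

lemma padicCoset_mod (a n : ℕ) :
    padicCoset p ((a % p ^ n : ℕ) : ℤ_[p]) n = padicCoset p (a : ℤ_[p]) n := by
  apply padicCoset_eq
  rw [natCast_mem_padicCoset]
  simp

lemma padicCoset_eq_closedBall (a : ℤ_[p]) (n : ℕ) :
    padicCoset p a n = Metric.closedBall a ((p : ℝ) ^ (-n : ℤ)) := by
  ext x
  rw [mem_padicCoset_norm, Metric.mem_closedBall, dist_eq_norm]

lemma isCompact_padicCoset (a : ℤ_[p]) (n : ℕ) : IsCompact (padicCoset p a n) := by
  rw [padicCoset_eq_closedBall]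
  exact Metric.isClosed_closedBall.isCompact

lemma isOpen_padicCoset (a : ℤ_[p]) (n : ℕ) : IsOpen (padicCoset p a n) := by
  rw [padicCoset_eq_closedBall]
  apply IsUltrametricDist.isOpen_closedBall
  have : (0 : ℝ) < p := by exact_mod_cast (Fact.out : p.Prime).pos
  positivity

lemma exists_rep (x : ℤ_[p]) (n : ℕ) : ∃ a < p ^ n, x ∈ padicCoset p (a : ℤ_[p]) n := by
  refine ⟨x.appr n, PadicInt.appr_lt x n, ?_⟩
  rw [mem_padicCoset_iff]
  exact Ideal.mem_span_singleton.1 (PadicInt.appr_spec n x)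

/-- Saturated sets of level `n`. -/
def Sat (n : ℕ) (U : Set ℤ_[p]) : Prop := ∀ x ∈ U, padicCoset p x n ⊆ U

lemma Sat.mono {m n : ℕ} {U : Set ℤ_[p]} (h : Sat m U) (hmn : m ≤ n) : Sat n U :=
  fun x hx => (padicCoset_subset hmn (self_mem_padicCoset x m)).trans (h x hx)

lemma sat_padicCoset (a : ℤ_[p]) {m n : ℕ} (hmn : m ≤ n) : Sat n (padicCoset p a m) :=
  fun _ hx => padicCoset_subset hmn hx

lemma Sat.union {n : ℕ} {U V : Set ℤ_[p]} (hU : Sat n U) (hV : Sat n V) : Sat n (U ∪ V) := by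
  rintro x (hx | hx)
  · exact (hU x hx).trans Set.subset_union_left
  · exact (hV x hx).trans Set.subset_union_right

lemma exists_sat {U : Set ℤ_[p]} (hc : IsCompact U) (ho : IsOpen U) : ∃ n, Sat n U := by
  obtain ⟨δ, hδ, h⟩ := hc.exists_thickening_subset_open ho (Set.Subset.refl U)
  obtain ⟨n, hn⟩ := PadicInt.exists_pow_neg_lt p hδ
  refine ⟨n, fun x hx y hy => h ?_⟩
  rw [Metric.mem_thickening_iff]
  refine ⟨x, hx, ?_⟩
  rw [mem_padicCoset_norm] at hy
  rw [dist_eq_norm]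
  exact hy.trans_lt hn

lemma Sat.mem_iff {n : ℕ} {U : Set ℤ_[p]} (hU : Sat n U) {x y : ℤ_[p]}
    (h : x ∈ padicCoset p y n) : x ∈ U ↔ y ∈ U :=
  ⟨fun hx => hU x hx (padicCoset_symm h), fun hy => hU y hy h⟩

lemma measure_empty (α : PadicMeasure p F) : α.toFun ∅ = 0 := by
  have := α.additive ∅ ∅ isCompact_empty isOpen_empty isCompact_empty isOpen_empty
    (Set.disjoint_empty _)
  simpa using this

lemma measure_biUnion (α : PadicMeasure p F) (n : ℕ) (s : Finset ℕ)
    (hs : ∀ a ∈ s, a < p ^ n) :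
    α.toFun (⋃ a ∈ s, padicCoset p (a : ℤ_[p]) n)
      = ∑ a ∈ s, α.toFun (padicCoset p (a : ℤ_[p]) n) := by
  induction s using Finset.induction_on with
  | empty => simp [measure_empty]
  | insert a s ha ih =>
    rw [Finset.sum_insert ha, Finset.set_biUnion_insert, α.additive, ih]
    · exact fun b hb => hs b (Finset.mem_insert_of_mem hb)
    · exact isCompact_padicCoset _ _
    · exact isOpen_padicCoset _ _
    · exact s.isCompact_biUnion fun _ _ => isCompact_padicCoset _ _
    · exact isOpen_biUnion fun _ _ => isOpen_padicCoset _ _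
    · rw [Set.disjoint_left]
      intro x hx hx2
      simp only [Set.mem_iUnion] at hx2
      obtain ⟨b, hb, hxb⟩ := hx2
      have h1 : (a : ℤ_[p]) ∈ padicCoset p (b : ℤ_[p]) n := by
        rw [← padicCoset_eq hxb]; exact padicCoset_symm hx
      rw [natCast_mem_padicCoset, Nat.mod_eq_of_lt (hs a (Finset.mem_insert_self _ _)),
        Nat.mod_eq_of_lt (hs b (Finset.mem_insert_of_mem hb))] at h1
      exact ha (h1 ▸ hb)

lemma measure_sat (α : PadicMeasure p F) (n : ℕ) (U : Set ℤ_[p]) (hU : Sat n U) :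
    α.toFun U = ∑ a ∈ Finset.range (p ^ n),
      if (a : ℤ_[p]) ∈ U then α.toFun (padicCoset p (a : ℤ_[p]) n) else 0 := by
  rw [← Finset.sum_filter, ← measure_biUnion α n]
  · congr 1
    ext x
    simp only [Set.mem_iUnion, Finset.mem_filter, Finset.mem_range]
    constructor
    · intro hx
      obtain ⟨a, ha, hxa⟩ := exists_rep x n
      exact ⟨a, ⟨ha, (hU.mem_iff hxa).1 hx⟩, hxa⟩
    · rintro ⟨a, ⟨_, ha⟩, hxa⟩
      exact (hU.mem_iff hxa).2 ha
  · intro a ha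
    exact Finset.mem_range.1 (Finset.mem_filter.1 ha).1

lemma sum_mod_eq (N b : ℕ) (hN : 0 < N) (φ : ℕ → F) (x : F) :
    ∑ a ∈ Finset.range N, φ a * (if b % N = a % N then x else 0) = φ (b % N) * x := by
  rw [Finset.sum_eq_single (b % N)]
  · simp
  · intro a ha hne
    rw [Nat.mod_eq_of_lt (Finset.mem_range.1 ha), if_neg (Ne.symm hne), mul_zero]
  · intro h
    exact absurd (Finset.mem_range.2 (Nat.mod_lt _ hN)) h

lemma integral_level (α : PadicMeasure p F) {m n : ℕ} (hmn : m ≤ n) (φ : ℕ → F) :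
    ∑ a ∈ Finset.range (p ^ m), φ a * α.toFun (padicCoset p (a : ℤ_[p]) m)
      = ∑ b ∈ Finset.range (p ^ n), φ (b % p ^ m) * α.toFun (padicCoset p (b : ℤ_[p]) n) := by
  have hp : 0 < p ^ m := pow_pos (Fact.out : p.Prime).pos _
  have h1 : ∀ a : ℕ, α.toFun (padicCoset p (a : ℤ_[p]) m) = ∑ b ∈ Finset.range (p ^ n),
      if b % p ^ m = a % p ^ m then α.toFun (padicCoset p (b : ℤ_[p]) n) else 0 := by
    intro a
    rw [measure_sat α n _ (sat_padicCoset _ hmn)]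
    simp only [natCast_mem_padicCoset]
  simp_rw [h1, Finset.mul_sum]
  rw [Finset.sum_comm]
  refine Finset.sum_congr rfl fun b _ => ?_
  exact sum_mod_eq _ _ hp _ _

lemma pow_mod_of {ζ : F} {N : ℕ} (h : ζ ^ N = 1) (b : ℕ) : ζ ^ (b % N) = ζ ^ b := by
  conv_rhs => rw [← Nat.div_add_mod b N, pow_add, pow_mul, h, one_pow, one_mul]

lemma fourier_level_le (α : PadicMeasure p F) {m n : ℕ} (hmn : m ≤ n) (ζ : F)
    (h : ζ ^ p ^ m = 1) : fourierAt α m ζ = fourierAt α n ζ := by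
  unfold fourierAt
  rw [integral_level α hmn (fun a => ζ ^ a)]
  simp only [pow_mod_of h]

/-- Building a measure from level-wise formulas. -/
lemma exists_measure (S : ℕ → Set ℤ_[p] → F)
    (h1 : ∀ m n U, m ≤ n → Sat m U → S m U = S n U)
    (h2 : ∀ n U V, Disjoint U V → S n (U ∪ V) = S n U + S n V) :
    ∃ α : PadicMeasure p F, ∀ n U, Sat n U → α.toFun U = S n U := by
  let f : Set ℤ_[p] → F := fun U => if h : ∃ n, Sat n U then S h.choose U else 0
  have hf : ∀ n U, Sat n U → f U = S n U := by
    intro n U hU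
    have h : ∃ n, Sat n U := ⟨n, hU⟩
    simp only [f, dif_pos h]
    rcases le_total h.choose n with hle | hle
    · exact h1 _ _ _ hle h.choose_spec
    · exact (h1 _ _ _ hle hU).symm
  refine ⟨⟨f, ?_⟩, hf⟩
  intro U V hUc hUo hVc hVo hd
  obtain ⟨m, hm⟩ := exists_sat hUc hUo
  obtain ⟨n, hn⟩ := exists_sat hVc hVo
  have hm' := hm.mono (le_max_left m n)
  have hn' := hn.mono (le_max_right m n)
  rw [hf _ _ (hm'.union hn'), hf _ _ hm', hf _ _ hn', h2 _ _ _ hd]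

lemma ite_union_eq {U V : Set ℤ_[p]} (hd : Disjoint U V) (x : ℤ_[p]) (c : F)
    [Decidable (x ∈ U ∪ V)] [Decidable (x ∈ U)] [Decidable (x ∈ V)] :
    (if x ∈ U ∪ V then c else 0) = (if x ∈ U then c else 0) + (if x ∈ V then c else 0) := by
  by_cases hU : x ∈ U
  · have hV : x ∉ V := Set.disjoint_left.1 hd hU
    simp [hU, hV]
  · simp [hU]

lemma natCast_mod_mem (a n : ℕ) :
    ((a % p ^ n : ℕ) : ℤ_[p]) ∈ padicCoset p (a : ℤ_[p]) n := by
  rw [natCast_mem_padicCoset]; simp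

lemma exists_convolution (α β : PadicMeasure p F) :
    ∃ γ : PadicMeasure p F, IsConvolution α β γ := by
  have Hγ := exists_measure (p := p) (F := F)
    (fun n U => ∑ a ∈ Finset.range (p ^ n), ∑ b ∈ Finset.range (p ^ n),
      (if ((a : ℤ_[p]) + (b : ℤ_[p])) ∈ U then
        α.toFun (padicCoset p (a : ℤ_[p]) n) * β.toFun (padicCoset p (b : ℤ_[p]) n) else 0))
  refine Exists.elim (Hγ ?_ ?_) (fun γ hγ => ?_)
  rotate_left 2
  · exact ⟨γ, fun n U _ _ h => hγ n U h⟩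
  · intro m n U hmn hU
    have e : ∀ k : ℕ, ∑ a ∈ Finset.range (p ^ k), ∑ b ∈ Finset.range (p ^ k),
      (if ((a : ℤ_[p]) + (b : ℤ_[p])) ∈ U then
        α.toFun (padicCoset p (a : ℤ_[p]) k) * β.toFun (padicCoset p (b : ℤ_[p]) k) else 0)
      = ∑ a ∈ Finset.range (p ^ k), (∑ b ∈ Finset.range (p ^ k),
      (if ((a : ℤ_[p]) + (b : ℤ_[p])) ∈ U then (1 : F) else 0) *
        β.toFun (padicCoset p (b : ℤ_[p]) k)) * α.toFun (padicCoset p (a : ℤ_[p]) k) := by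
      intro k
      refine Finset.sum_congr rfl fun a _ => ?_
      rw [Finset.sum_mul]
      refine Finset.sum_congr rfl fun b _ => ?_
      split_ifs <;> ring
    simp only [e]
    rw [integral_level α hmn (fun a => ∑ b ∈ Finset.range (p ^ m),
      (if ((a : ℤ_[p]) + (b : ℤ_[p])) ∈ U then (1 : F) else 0) *
        β.toFun (padicCoset p (b : ℤ_[p]) m))]
    refine Finset.sum_congr rfl fun a _ => ?_
    congr 1
    rw [integral_level β hmn (fun b =>
      (if (((a % p ^ m : ℕ) : ℤ_[p]) + (b : ℤ_[p])) ∈ U then (1 : F) else 0))]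
    refine Finset.sum_congr rfl fun b _ => ?_
    congr 1
    have hk : ((a % p ^ m : ℕ) : ℤ_[p]) + ((b % p ^ m : ℕ) : ℤ_[p]) ∈ U
        ↔ (a : ℤ_[p]) + (b : ℤ_[p]) ∈ U := by
      apply hU.mem_iff
      have ha := natCast_mod_mem (p := p) a m
      have hb := natCast_mod_mem (p := p) b m
      rw [mem_padicCoset_iff] at *
      have := dvd_add ha hb
      convert this using 1
      ring
    simp only [hk]
  · intro n U V hd
    simp only [ite_union_eq hd, Finset.sum_add_distrib]

lemma fourier_mul (α β γ : PadicMeasure p F) (hc : IsConvolution α β γ) (n : ℕ) (ζ : F)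
    (h : ζ ^ p ^ n = 1) : fourierAt γ n ζ = fourierAt α n ζ * fourierAt β n ζ := by
  have hp : 0 < p ^ n := pow_pos (Fact.out : p.Prime).pos _
  unfold fourierAt
  have h1 : ∀ k : ℕ, γ.toFun (padicCoset p (k : ℤ_[p]) n) =
      ∑ a ∈ Finset.range (p ^ n), ∑ b ∈ Finset.range (p ^ n),
      (if (a + b) % p ^ n = k % p ^ n then
        α.toFun (padicCoset p (a : ℤ_[p]) n) * β.toFun (padicCoset p (b : ℤ_[p]) n) else 0) := by
    intro k
    rw [hc n _ (isCompact_padicCoset _ _) (isOpen_padicCoset _ _) (sat_padicCoset _ le_rfl)]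
    simp only [← Nat.cast_add, natCast_mem_padicCoset]
  simp_rw [h1]
  rw [Finset.sum_mul_sum]
  simp_rw [Finset.mul_sum]
  rw [Finset.sum_comm]
  refine Finset.sum_congr rfl fun a _ => ?_
  rw [Finset.sum_comm]
  refine Finset.sum_congr rfl fun b _ => ?_
  rw [sum_mod_eq _ _ hp (fun k => ζ ^ k), pow_mod_of h, pow_add]
  ring

lemma geom_root {x : F} {N : ℕ} (h : x ^ N = 1) :
    ∑ j ∈ Finset.range N, x ^ j = if x = 1 then (N : F) else 0 := by
  split_ifs with hx
  · simp [hx]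
  · have := geom_sum_mul x N
    rw [h, sub_self] at this
    exact (mul_eq_zero.1 this).resolve_right (sub_ne_zero.2 hx)

lemma mem_roots_iff (n : ℕ) (ζ : F) :
    ζ ∈ (Polynomial.nthRoots (p ^ n) (1 : F)).toFinset ↔ ζ ^ p ^ n = 1 := by
  rw [Multiset.mem_toFinset, Polynomial.mem_nthRoots (pow_pos (Fact.out : p.Prime).pos _)]

lemma sum_roots {N : ℕ} (hN : 0 < N) {η : F} (hη : IsPrimitiveRoot η N) (f : F → F) :
    ∑ ζ ∈ (Polynomial.nthRoots N (1 : F)).toFinset, f ζ = ∑ i ∈ Finset.range N, f (η ^ i) := by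
  have : (Polynomial.nthRoots N (1 : F)).toFinset = (Finset.range N).image (η ^ ·) := by
    ext ζ
    rw [Multiset.mem_toFinset, Polynomial.mem_nthRoots hN, Finset.mem_image]
    constructor
    · intro h
      have : NeZero N := ⟨hN.ne'⟩
      obtain ⟨i, hi, e⟩ := hη.eq_pow_of_pow_eq_one h
      exact ⟨i, Finset.mem_range.2 hi, e⟩
    · rintro ⟨i, _, rfl⟩
      rw [← pow_mul, mul_comm, pow_mul, hη.pow_eq_one, one_pow]
  rw [this, Finset.sum_image]
  intro i hi j hj e
  exact hη.pow_inj (by simpa using hi) (by simpa using hj) e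

lemma ortho {N : ℕ} (hN : 0 < N) {η : F} (hη : IsPrimitiveRoot η N) (a b : ℕ) :
    ∑ ζ ∈ (Polynomial.nthRoots N (1 : F)).toFinset, ζ ^ b * (ζ⁻¹) ^ a
      = if b % N = a % N then (N : F) else 0 := by
  have h0 : η ≠ 0 := hη.ne_zero hN.ne'
  rw [sum_roots hN hη]
  have e : ∀ i : ℕ, (η ^ i) ^ b * ((η ^ i)⁻¹) ^ a = (η ^ b * (η⁻¹) ^ a) ^ i := by
    intro i
    rw [← inv_pow, mul_pow, ← pow_mul, ← pow_mul, ← pow_mul, ← pow_mul, mul_comm i, mul_comm i]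
  simp only [e]
  rw [geom_root]
  · have : η ^ b * (η⁻¹) ^ a = 1 ↔ b % N = a % N := by
      rw [inv_pow, mul_inv_eq_one₀ (pow_ne_zero _ h0), ← pow_mod_of hη.pow_eq_one b,
        ← pow_mod_of hη.pow_eq_one a]
      exact ⟨fun h => hη.pow_inj (Nat.mod_lt _ hN) (Nat.mod_lt _ hN) h, fun h => by rw [h]⟩
    simp only [this]
  · rw [mul_pow, ← pow_mul, ← pow_mul, mul_comm b, mul_comm a, pow_mul, pow_mul, inv_pow,
      hη.pow_eq_one]
    simp

lemma inversion (hp0 : (p : F) ≠ 0) (n : ℕ) {η : F} (hη : IsPrimitiveRoot η (p ^ n))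
    (α : PadicMeasure p F) (a : ℕ) :
    α.toFun (padicCoset p (a : ℤ_[p]) n) =
      ((p : F) ^ n)⁻¹ * ∑ ζ ∈ (Polynomial.nthRoots (p ^ n) (1 : F)).toFinset,
        fourierAt α n ζ * (ζ⁻¹) ^ a := by
  have hp : 0 < p ^ n := pow_pos (Fact.out : p.Prime).pos _
  have e : ∑ ζ ∈ (Polynomial.nthRoots (p ^ n) (1 : F)).toFinset, fourierAt α n ζ * (ζ⁻¹) ^ a
      = ∑ b ∈ Finset.range (p ^ n), α.toFun (padicCoset p (b : ℤ_[p]) n) *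
        (if a % p ^ n = b % p ^ n then ((p ^ n : ℕ) : F) else 0) := by
    unfold fourierAt
    simp_rw [Finset.sum_mul]
    rw [Finset.sum_comm]
    refine Finset.sum_congr rfl fun b _ => ?_
    rw [if_congr (eq_comm (a := a % p ^ n)) rfl rfl, ← ortho hp hη a b, Finset.mul_sum]
    refine Finset.sum_congr rfl fun ζ _ => ?_
    ring
  rw [e, sum_mod_eq _ _ hp (fun b => α.toFun (padicCoset p (b : ℤ_[p]) n)), padicCoset_mod]
  push_cast
  field_simp

lemma sum_range_mul_split (N k : ℕ) (f : ℕ → F) :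
    ∑ b ∈ Finset.range (N * k), f b
      = ∑ j ∈ Finset.range k, ∑ a ∈ Finset.range N, f (N * j + a) := by
  induction k with
  | zero => simp
  | succ k ih => rw [Nat.mul_succ, Finset.sum_range_add, ih, Finset.sum_range_succ]

lemma surj (hp0 : (p : F) ≠ 0) (g : F → F) :
    ∃ α : PadicMeasure p F, ∀ (ζ : F) (n : ℕ), ζ ^ p ^ n = 1 → fourierAt α n ζ = g ζ := by
  have Hα := exists_measure (p := p) (F := F)
    (fun n U => ((p : F) ^ n)⁻¹ * ∑ ζ ∈ (Polynomial.nthRoots (p ^ n) (1 : F)).toFinset,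
      g ζ * ∑ a ∈ Finset.range (p ^ n), if (a : ℤ_[p]) ∈ U then (ζ⁻¹) ^ a else 0)
  refine Exists.elim (Hα ?_ ?_) (fun α hα => ?_)
  rotate_left 2
  · refine ⟨α, fun ζ n h => ?_⟩
    have hp : 0 < p ^ n := pow_pos (Fact.out : p.Prime).pos _
    have h1 : ∀ k ∈ Finset.range (p ^ n), ζ ^ k * α.toFun (padicCoset p (k : ℤ_[p]) n) =
        ∑ ξ ∈ (Polynomial.nthRoots (p ^ n) (1 : F)).toFinset,
          ((p : F) ^ n)⁻¹ * g ξ * (ζ * ξ⁻¹) ^ k := by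
      intro k hk
      rw [hα n _ (sat_padicCoset _ le_rfl), ← mul_assoc, Finset.mul_sum]
      refine Finset.sum_congr rfl fun ξ _ => ?_
      have : (∑ a ∈ Finset.range (p ^ n),
          if (a : ℤ_[p]) ∈ padicCoset p (k : ℤ_[p]) n then (ξ⁻¹) ^ a else 0) = (ξ⁻¹) ^ k := by
        simp only [natCast_mem_padicCoset]
        rw [Finset.sum_eq_single k]
        · simp
        · intro a ha hne
          rw [Nat.mod_eq_of_lt (Finset.mem_range.1 ha), Nat.mod_eq_of_lt (Finset.mem_range.1 hk),
            if_neg hne]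
        · exact fun h => absurd hk h
      rw [this, mul_pow]
      ring
    unfold fourierAt
    rw [Finset.sum_congr rfl h1, Finset.sum_comm, Finset.sum_eq_single ζ]
    · have hz : ζ ≠ 0 := by
        rintro rfl
        rw [zero_pow hp.ne'] at h
        exact zero_ne_one h
      simp [mul_inv_cancel₀ hz]
      field_simp
    · intro ξ hξ hne
      rw [mem_roots_iff] at hξ
      have hz : ξ ≠ 0 := by
        rintro rfl
        rw [zero_pow hp.ne'] at hξ
        exact zero_ne_one hξ
      rw [← Finset.mul_sum, geom_root, if_neg, mul_zero]
      · rw [mul_inv_eq_one₀ hz]; exact Ne.symm hne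
      · rw [mul_pow, inv_pow, h, hξ]; simp
    · intro hn
      exact absurd ((mem_roots_iff n ζ).2 h) hn
  · intro m n U hmn hU
    obtain ⟨d, rfl⟩ := Nat.exists_eq_add_of_le hmn
    have key : ∀ ζ ∈ (Polynomial.nthRoots (p ^ (m + d)) (1 : F)).toFinset,
        g ζ * (∑ a ∈ Finset.range (p ^ (m + d)), if (a : ℤ_[p]) ∈ U then (ζ⁻¹) ^ a else 0)
        = if ζ ^ p ^ m = 1 then (p : F) ^ d * (g ζ * ∑ a ∈ Finset.range (p ^ m),
          if (a : ℤ_[p]) ∈ U then (ζ⁻¹) ^ a else 0) else 0 := by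
      intro ζ hζ
      rw [mem_roots_iff] at hζ
      have hs : (∑ a ∈ Finset.range (p ^ (m + d)), if (a : ℤ_[p]) ∈ U then (ζ⁻¹) ^ a else 0)
          = (∑ j ∈ Finset.range (p ^ d), ((ζ⁻¹) ^ p ^ m) ^ j) *
            ∑ a ∈ Finset.range (p ^ m), if (a : ℤ_[p]) ∈ U then (ζ⁻¹) ^ a else 0 := by
        rw [pow_add, sum_range_mul_split, Finset.sum_mul]
        refine Finset.sum_congr rfl fun j _ => ?_
        rw [Finset.mul_sum]
        refine Finset.sum_congr rfl fun a _ => ?_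
        have hk : ((p ^ m * j + a : ℕ) : ℤ_[p]) ∈ U ↔ (a : ℤ_[p]) ∈ U := by
          apply hU.mem_iff
          rw [natCast_mem_padicCoset]
          simp
        simp only [hk]
        split_ifs
        · rw [pow_add, pow_mul]
        · simp
      rw [hs, geom_root]
      · have : (ζ⁻¹) ^ p ^ m = 1 ↔ ζ ^ p ^ m = 1 := by rw [inv_pow, inv_eq_one]
        simp only [this]
        split_ifs
        · push_cast; ring
        · simp
      · rw [← pow_mul, ← pow_add, inv_pow, hζ, inv_one]
    rw [Finset.sum_congr rfl key, ← Finset.sum_filter]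
    have hset : (Polynomial.nthRoots (p ^ (m + d)) (1 : F)).toFinset.filter
        (fun ζ => ζ ^ p ^ m = 1) = (Polynomial.nthRoots (p ^ m) (1 : F)).toFinset := by
      ext ζ
      rw [Finset.mem_filter, mem_roots_iff, mem_roots_iff]
      refine ⟨fun h => h.2, fun h => ⟨?_, h⟩⟩
      rw [pow_add, pow_mul, h, one_pow]
    rw [hset, ← Finset.mul_sum, pow_add]
    field_simp
  · intro n U V hd
    simp only [ite_union_eq hd, Finset.sum_add_distrib, mul_add]

end Helpers

theorem fourier_transform_ring_iso (p ℓ : ℕ) [Fact p.Prime] [Fact ℓ.Prime] (hpl : p ≠ ℓ) :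
    letI F := AlgebraicClosure (ZMod ℓ)
    -- the Fourier transform is well defined as a function on `μ_{p^∞}`:
    (∀ (α : PadicMeasure p F) (m n : ℕ) (ζ : F), ζ ^ p ^ m = 1 → ζ ^ p ^ n = 1 →
        fourierAt α m ζ = fourierAt α n ζ) ∧
    -- it is additive:
    (∀ (α β : PadicMeasure p F) (n : ℕ) (ζ : F), ζ ^ p ^ n = 1 →
        fourierAt (α + β) n ζ = fourierAt α n ζ + fourierAt β n ζ) ∧
    -- it is multiplicative (convolutions exist, and are taken to pointwise products):
    (∀ (α β : PadicMeasure p F), ∃ γ : PadicMeasure p F, IsConvolution α β γ) ∧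
    (∀ (α β γ : PadicMeasure p F), IsConvolution α β γ →
        ∀ (n : ℕ) (ζ : F), ζ ^ p ^ n = 1 →
          fourierAt γ n ζ = fourierAt α n ζ * fourierAt β n ζ) ∧
    -- it is injective (on compact open sets):
    (∀ α β : PadicMeasure p F,
        (∀ (n : ℕ) (ζ : F), ζ ^ p ^ n = 1 → fourierAt α n ζ = fourierAt β n ζ) →
        ∀ U : Set ℤ_[p], IsCompact U → IsOpen U → α.toFun U = β.toFun U) ∧
    -- it is surjective onto the ring of all `F`-valued functions on `μ_{p^∞}`:
    (∀ g : muPInfty p F → F, ∃ α : PadicMeasure p F,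
        ∀ (ζ : F) (n : ℕ) (h : ζ ^ p ^ n = 1), fourierAt α n ζ = g ⟨ζ, n, h⟩) ∧
    -- and its inverse is the Fourier inversion `f ↦ f̌`:
    (∀ (α : PadicMeasure p F) (n : ℕ) (a : ℕ),
        α.toFun (padicCoset p (a : ℤ_[p]) n) =
          ((p : F) ^ n)⁻¹ * ∑ ζ ∈ (Polynomial.nthRoots (p ^ n) (1 : F)).toFinset,
            fourierAt α n ζ * (ζ⁻¹) ^ a) := by
  have hp0 : (p : AlgebraicClosure (ZMod ℓ)) ≠ 0 := by
    have : CharP (AlgebraicClosure (ZMod ℓ)) ℓ :=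
      charP_of_injective_algebraMap (algebraMap (ZMod ℓ) _).injective ℓ
    intro h
    rw [CharP.cast_eq_zero_iff (AlgebraicClosure (ZMod ℓ)) ℓ] at h
    exact hpl ((Nat.prime_dvd_prime_iff_eq Fact.out Fact.out).1 h).symm
  have hprim : ∀ n : ℕ, ∃ η : AlgebraicClosure (ZMod ℓ), IsPrimitiveRoot η (p ^ n) := by
    intro n
    have : NeZero ((p ^ n : ℕ) : AlgebraicClosure (ZMod ℓ)) :=
      ⟨by push_cast; exact pow_ne_zero _ hp0⟩
    exact HasEnoughRootsOfUnity.exists_primitiveRoot _ _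
  refine ⟨?_, ?_, exists_convolution, fourier_mul, ?_, ?_, ?_⟩
  · intro α m n ζ hm hn
    rcases le_total m n with h | h
    · exact fourier_level_le α h ζ hm
    · exact (fourier_level_le α h ζ hn).symm
  · intro α β n ζ _
    unfold fourierAt
    rw [← Finset.sum_add_distrib]
    exact Finset.sum_congr rfl fun a _ => mul_add _ _ _
  · intro α β h U hc ho
    obtain ⟨n, hn⟩ := exists_sat hc ho
    obtain ⟨η, hη⟩ := hprim n
    rw [measure_sat α n U hn, measure_sat β n U hn]
    refine Finset.sum_congr rfl fun a _ => ?_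
    rw [inversion hp0 n hη α a, inversion hp0 n hη β a]
    congr 2
    refine Finset.sum_congr rfl fun ζ hζ => ?_
    rw [h n ζ ((mem_roots_iff n ζ).1 hζ)]
  · intro g
    obtain ⟨α, hα⟩ := surj (p := p) hp0
      (fun ζ => if h : ∃ n : ℕ, ζ ^ p ^ n = 1 then g ⟨ζ, h⟩ else 0)
    refine ⟨α, fun ζ n h => ?_⟩
    rw [hα ζ n h, dif_pos ⟨n, h⟩]
  · intro α n a
    obtain ⟨η, hη⟩ := hprim n
    exact inversion hp0 n hη α a
end

section
/- Let χ be a nontrivial Dirichlet character of conductor f_χ and k ≥ 0 an integer. Then the rational function D^k F_χ(Z), where D = Z·d/dZ, is regular at Z = 1 and L(-k, χ) = (D^k F_χ)(1). -/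
/-!
STATEMENT 5: For a nontrivial Dirichlet character `χ` of conductor `f_χ` and an
integer `k ≥ 0`, the rational function `D^k F_χ(Z)` (`D = Z d/dZ`) is regular at
`Z = 1` and `L(-k, χ) = (D^k F_χ)(1)`.
-/

open scoped BigOperators Classical

/-- The generalized Bernoulli number `B_{n,χ}` computed at the modulus `N` of `χ`:
`∑_{a=1}^{N} χ(a) t e^{at} / (e^{Nt} - 1) = ∑_{n ≥ 0} B_{n,χ} t^n / n!`. -/
noncomputable def genBernoulli {K : Type*} [Field K] [CharZero K] {N : ℕ}
    (χ : DirichletCharacter K N) (n : ℕ) : K :=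
  (n.factorial : K) * (PowerSeries.coeff n)
    ((∑ a ∈ Finset.Icc 1 N, PowerSeries.C (χ (a : ZMod N)) *
        PowerSeries.rescale ((a : K)) (PowerSeries.exp K)) *
      (PowerSeries.mk fun m => (N : K) ^ (m + 1) / ((m + 1).factorial : K))⁻¹)

/-- The value `L(-k, χ) = -B_{k+1,χ}/(k+1)` of the Dirichlet `L`-function of `χ`
at `s = -k`, computed at the modulus of `χ` (the honest `L`-value when `χ` is
primitive). -/
noncomputable def LvalAt {K : Type*} [Field K] [CharZero K] {N : ℕ}
    (χ : DirichletCharacter K N) (k : ℕ) : K :=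
  -genBernoulli χ (k + 1) / (k + 1)

/-- The operator `D = Z d/dZ` on rational functions. -/
noncomputable def Dop {K : Type*} [Field K] (R : RatFunc K) : RatFunc K :=
  RatFunc.X * (algebraMap (Polynomial K) (RatFunc K)
      (Polynomial.derivative R.num * R.denom - R.num * Polynomial.derivative R.denom) /
    algebraMap (Polynomial K) (RatFunc K) (R.denom ^ 2))

/-- `F_χ(Z) = (∑_{a=1}^{f} χ(a) Z^a)/(1 - Z^f)`. -/
noncomputable def Fchi {K : Type*} [Field K] {N : ℕ} (χ : DirichletCharacter K N)
    (f : ℕ) : RatFunc K :=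
  (∑ a ∈ Finset.Icc 1 f, RatFunc.C (χ (a : ZMod N)) * RatFunc.X ^ a) /
    (1 - RatFunc.X ^ f)

/-- Substituting `Z = e^t`. -/
noncomputable def EE (K : Type*) [Field K] [CharZero K] : Polynomial K →ₐ[K] PowerSeries K :=
  Polynomial.aeval (PowerSeries.exp K)

lemma EE_const {K : Type*} [Field K] [CharZero K] (p : Polynomial K) :
    PowerSeries.constantCoeff (EE K p) = p.eval 1 := by
  induction p using Polynomial.induction_on' with
  | add p q hp hq => simp [hp, hq]
  | monomial n a =>
    simp [EE, Polynomial.aeval_monomial]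

lemma EE_deriv {K : Type*} [Field K] [CharZero K] (p : Polynomial K) :
    PowerSeries.derivative K (EE K p)
      = EE K (Polynomial.X * Polynomial.derivative p) := by
  have hexp : PowerSeries.derivative K (PowerSeries.exp K) = PowerSeries.exp K := by
    ext n
    simp only [PowerSeries.coeff_derivative,
      PowerSeries.coeff_exp, Nat.factorial_succ]
    have h1 : (n.factorial : K) ≠ 0 := by exact_mod_cast n.factorial_ne_zero
    have h2 : (n + 1 : K) ≠ 0 := by exact_mod_cast n.succ_ne_zero
    push_cast
    field_simp
  have h := Derivation.map_aeval (PowerSeries.derivative K) p (PowerSeries.exp K)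
  rw [hexp] at h
  simp only [EE] at *
  rw [h, map_mul, Polynomial.aeval_X, smul_eq_mul, mul_comm]

/-- `R` is regular at `1` with expansion `s` in `t`, `Z = e^t`. -/
def ExpRel {K : Type*} [Field K] [CharZero K] (R : RatFunc K) (s : PowerSeries K) : Prop :=
  R.denom.eval 1 ≠ 0 ∧ EE K R.num = s * EE K R.denom

lemma EE_ne {K : Type*} [Field K] [CharZero K] {q : Polynomial K} (hq : q.eval 1 ≠ 0) :
    EE K q ≠ 0 := by
  intro h
  apply hq
  rw [← EE_const, h, map_zero]

lemma ExpRel.mk' {K : Type*} [Field K] [CharZero K] {p q : Polynomial K} {s : PowerSeries K}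
    (hq : q.eval 1 ≠ 0) (h : EE K p = s * EE K q) :
    ExpRel (algebraMap (Polynomial K) (RatFunc K) p / algebraMap (Polynomial K) (RatFunc K) q)
      s := by
  have hq0 : q ≠ 0 := by rintro rfl; simp at hq
  set R := algebraMap (Polynomial K) (RatFunc K) p / algebraMap (Polynomial K) (RatFunc K) q
    with hR
  have hd : R.denom ∣ q := RatFunc.denom_div_dvd p q
  have hn : R.num * q = p * R.denom := (RatFunc.num_mul_eq_mul_denom_iff hq0).2 hR
  refine ⟨?_, ?_⟩
  · intro h0
    obtain ⟨c, hc⟩ := hd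
    apply hq
    rw [hc, Polynomial.eval_mul, h0, zero_mul]
  · have := congrArg (EE K) hn
    rw [map_mul, map_mul, h] at this
    apply mul_right_cancel₀ (EE_ne hq)
    rw [this]; ring

lemma ExpRel.dop {K : Type*} [Field K] [CharZero K] {R : RatFunc K} {s : PowerSeries K}
    (h : ExpRel R s) : ExpRel (Dop R) (PowerSeries.derivative K s) := by
  obtain ⟨h1, h2⟩ := h
  have : Dop R = algebraMap (Polynomial K) (RatFunc K) (Polynomial.X *
      (Polynomial.derivative R.num * R.denom - R.num * Polynomial.derivative R.denom)) /
    algebraMap (Polynomial K) (RatFunc K) (R.denom ^ 2) := by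
    rw [Dop, map_mul, RatFunc.algebraMap_X, mul_div_assoc]
  rw [this]
  apply ExpRel.mk'
  · simpa using h1
  · have e1 := EE_deriv R.num
    have e2 := EE_deriv R.denom
    rw [h2, Derivation.leibniz] at e1
    simp only [smul_eq_mul] at e1
    simp only [map_mul, map_sub, map_pow] at *
    rw [h2]
    linear_combination (-(EE K R.denom)) * e1 + s * (EE K R.denom) * e2

lemma ExpRel.iter {K : Type*} [Field K] [CharZero K] {R : RatFunc K} {s : PowerSeries K}
    (h : ExpRel R s) (k : ℕ) :
    ExpRel (Dop^[k] R) ((PowerSeries.derivative K)^[k] s) := by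
  induction k with
  | zero => exact h
  | succ k ih => rw [Function.iterate_succ_apply', Function.iterate_succ_apply']; exact ih.dop

lemma const_iter {K : Type*} [Field K] [CharZero K] (s : PowerSeries K) (k : ℕ) :
    PowerSeries.constantCoeff ((PowerSeries.derivative K)^[k] s)
      = k.factorial * PowerSeries.coeff k s := by
  induction k generalizing s with
  | zero => simp
  | succ k ih =>
    rw [Function.iterate_succ_apply, ih, PowerSeries.coeff_derivative, Nat.factorial_succ]
    push_cast; ring

lemma Dop_zero_iter {K : Type*} [Field K] (k : ℕ) : Dop^[k] (0 : RatFunc K) = 0 := by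
  induction k with
  | zero => rfl
  | succ k ih => rw [Function.iterate_succ_apply', ih]; simp [Dop]

lemma sum_Icc_eq {K : Type*} [Field K] {N : ℕ} [NeZero N] (χ : DirichletCharacter K N) :
    ∑ a ∈ Finset.Icc 1 N, χ (a : ZMod N) = ∑ a : ZMod N, χ a := by
  refine Finset.sum_bij' (fun a _ => (a : ZMod N))
    (fun b _ => if b.val = 0 then N else b.val) ?_ ?_ ?_ ?_ ?_
  · simp
  · intro b _
    have := b.val_lt
    have := NeZero.pos N
    simp only [Finset.mem_Icc]
    split_ifs <;> omega
  · intro a ha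
    simp only [Finset.mem_Icc] at ha
    simp only [ZMod.val_natCast]
    rcases ha.2.lt_or_eq with h | h
    · rw [Nat.mod_eq_of_lt h, if_neg (by omega)]
    · simp [h]
  · intro b _
    split_ifs with h
    · rw [ZMod.natCast_self]; exact ((ZMod.val_eq_zero b).1 h).symm
    · simp
  · simp

lemma base {K : Type*} [Field K] [CharZero K] {N : ℕ} [NeZero N]
    (χ : DirichletCharacter K N) (hχ : χ ≠ 1) :
    ∃ s : PowerSeries K, ExpRel (Fchi χ N) s ∧ ∀ k : ℕ,
      (k.factorial : K) * PowerSeries.coeff k s = LvalAt χ k := by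
  have hN : (N : K) ≠ 0 := by exact_mod_cast NeZero.ne N
  set P : Polynomial K := ∑ a ∈ Finset.Icc 1 N,
    Polynomial.C (χ (a : ZMod N)) * Polynomial.X ^ a with hP
  have hP1 : P.eval 1 = 0 := by
    simp only [hP, Polynomial.eval_finsetSum, Polynomial.eval_mul, Polynomial.eval_C,
      Polynomial.eval_pow, Polynomial.eval_X, one_pow, mul_one]
    rw [sum_Icc_eq, MulChar.sum_eq_zero_of_ne_one hχ]
  obtain ⟨P1, hP1'⟩ := Polynomial.dvd_iff_isRoot.2 hP1
  set G : Polynomial K := ∑ i ∈ Finset.range N, Polynomial.X ^ i with hG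
  have hG1 : (-G).eval 1 ≠ 0 := by
    simpa [hG, Polynomial.eval_finsetSum] using hN
  have hGX : G * (Polynomial.X - 1) = Polynomial.X ^ N - 1 := geom_sum_mul _ _
  rw [map_one] at hP1'
  have hX1 : (Polynomial.X - 1 : Polynomial K) ≠ 0 := by
    simpa using Polynomial.X_sub_C_ne_zero (1 : K)
  have hF : Fchi χ N = algebraMap (Polynomial K) (RatFunc K) P1 /
      algebraMap (Polynomial K) (RatFunc K) (-G) := by
    have h1 : Fchi χ N = algebraMap (Polynomial K) (RatFunc K) P /
      algebraMap (Polynomial K) (RatFunc K) (1 - Polynomial.X ^ N) := by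
      simp [Fchi, hP, map_sum, RatFunc.algebraMap_X, RatFunc.algebraMap_C]
    have h2 : (1 - Polynomial.X ^ N : Polynomial K) = (Polynomial.X - 1) * (-G) := by
      linear_combination hGX
    rw [h1, h2, hP1', map_mul, map_mul, mul_div_mul_left]
    exact RatFunc.algebraMap_ne_zero hX1
  have hc : PowerSeries.constantCoeff (EE K (-G)) ≠ 0 := by rwa [EE_const]
  refine ⟨EE K P1 * (EE K (-G))⁻¹, ?_, ?_⟩
  · rw [hF]
    refine ExpRel.mk' hG1 ?_
    rw [mul_assoc, PowerSeries.inv_mul_cancel _ hc, mul_one]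
  · intro k
    set s := EE K P1 * (EE K (-G))⁻¹ with hs
    have hs1 : EE K P1 = s * EE K (-G) := by
      rw [hs, mul_assoc, PowerSeries.inv_mul_cancel _ hc, mul_one]
    set M : PowerSeries K := PowerSeries.mk fun m => (N : K) ^ (m + 1) / ((m + 1).factorial : K)
      with hM
    have hMc : PowerSeries.constantCoeff M ≠ 0 := by
      rw [← PowerSeries.coeff_zero_eq_constantCoeff_apply]; simpa [hM] using hN
    have hres : ∀ a : ℕ, PowerSeries.rescale (a : K) (PowerSeries.exp K)
        = PowerSeries.exp K ^ a := fun a => (PowerSeries.exp_pow_eq_rescale_exp a).symm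
    have hMX : EE K (Polynomial.X ^ N - 1) = PowerSeries.X * M := by
      rw [map_sub, map_pow, map_one, EE, Polynomial.aeval_X, ← hres]
      ext n
      cases n with
      | zero => simp [hres]
      | succ n =>
        rw [PowerSeries.coeff_succ_X_mul]
        simp [hM, PowerSeries.coeff_rescale, PowerSeries.coeff_exp, PowerSeries.coeff_one,
          div_eq_mul_inv]
    have hEP : (∑ a ∈ Finset.Icc 1 N, PowerSeries.C (χ (a : ZMod N)) *
        PowerSeries.rescale ((a : K)) (PowerSeries.exp K)) = EE K P := by
      simp only [hP, map_sum, map_mul, map_pow, hres, EE, Polynomial.aeval_X,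
        Polynomial.aeval_C, PowerSeries.algebraMap_eq]
    have hB : EE K P * M⁻¹ = PowerSeries.X * (-s) := by
      have : EE K P = PowerSeries.X * (-s) * M := by
        have h3 : PowerSeries.X * M = EE K G * EE K (Polynomial.X - 1) := by
          rw [← hMX, ← hGX, map_mul]
        rw [hP1', map_mul, hs1, map_neg]
        linear_combination s * h3
      rw [this, mul_assoc, PowerSeries.mul_inv_cancel _ hMc, mul_one]
    have h2 : (k + 1 : K) ≠ 0 := by exact_mod_cast k.succ_ne_zero
    rw [LvalAt, genBernoulli, hEP, hB, PowerSeries.coeff_succ_X_mul, Nat.factorial_succ]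
    push_cast
    rw [map_neg]
    field_simp

theorem L_value_eq_Dk_Fchi_at_one {K : Type*} [Field K] [CharZero K] {fχ : ℕ}
    (χ : DirichletCharacter K fχ) (hχ : χ ≠ 1) (hprim : χ.IsPrimitive) (k : ℕ) :
    (Dop^[k] (Fchi χ fχ)).denom.eval 1 ≠ 0 ∧
      RatFunc.eval (RingHom.id K) 1 (Dop^[k] (Fchi χ fχ)) = LvalAt χ k := by
  rcases Nat.eq_zero_or_pos fχ with h0 | hpos
  · subst h0
    have : Fchi χ 0 = 0 := by simp [Fchi]
    rw [this, Dop_zero_iter]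
    simp [LvalAt, genBernoulli]
  · have : NeZero fχ := ⟨hpos.ne'⟩
    obtain ⟨s, hs, hL⟩ := base χ hχ
    obtain ⟨h1, h2⟩ := hs.iter k
    refine ⟨h1, ?_⟩
    have h3 := congrArg PowerSeries.constantCoeff h2
    rw [map_mul, EE_const, EE_const, const_iter, hL] at h3
    rw [RatFunc.eval, Polynomial.eval₂_id, Polynomial.eval₂_id, h3]
    field_simp
end
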